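/- arXiv:2011.06389 — 7 statements merged into one kernel-verified Lean document; each statement's English description precedes it below -/
import Mathlib

section
/- For every real number α with 1 < α < 2 and every real u > 0, one has (α(α−1)/Γ(2−α)) · ∫_0^∞ z^{1−α} · (∫_0^1 (u+v·z)^{−2}·(1−v) dv) dz = Γ(α) · u^{−α}. -/
open MeasureTheory

lemma aux_gamma (a r : ℝ) (ha : 0 < a) (hr : 0 < r) :
    ∫⁻ t in Set.Ioi (0:ℝ), ENNReal.ofReal (t ^ (a - 1) * Real.exp (-(r * t))) =
      ENNReal.ofReal ((1 / r) ^ a * Real.Gamma a) := by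
  have h := Real.integral_rpow_mul_exp_neg_mul_Ioi ha hr
  have hpos : 0 < (1 / r) ^ a * Real.Gamma a :=
    mul_pos (Real.rpow_pos_of_pos (by positivity) _) (Real.Gamma_pos_of_pos ha)
  rw [← h, ofReal_integral_eq_lintegral_ofReal]
  · by_contra hc
    rw [integral_undef hc] at h
    linarith
  · filter_upwards [ae_restrict_mem measurableSet_Ioi] with t ht
    have : (0:ℝ) < t := ht
    simp only [Pi.zero_apply]
    positivity

lemma aux_inner (α u v : ℝ) (hα1 : 1 < α) (hα2 : α < 2) (hu : 0 < u) (hv : 0 < v) :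
    ∫⁻ z in Set.Ioi (0:ℝ), ENNReal.ofReal (z ^ (1 - α) * (u + v * z) ^ (-2 : ℝ)) =
      ENNReal.ofReal (Real.Gamma (2 - α) * Real.Gamma α * u ^ (-α) * v ^ (α - 2)) := by
  have hG2 : 0 < Real.Gamma (2 - α) := Real.Gamma_pos_of_pos (by linarith)
  have hG : 0 < Real.Gamma α := Real.Gamma_pos_of_pos (by linarith)
  have h1 : ∫⁻ z in Set.Ioi (0:ℝ), ENNReal.ofReal (z ^ (1 - α) * (u + v * z) ^ (-2 : ℝ)) =
      ∫⁻ z in Set.Ioi (0:ℝ), ∫⁻ t in Set.Ioi (0:ℝ),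
        ENNReal.ofReal (z ^ (1 - α) * (t * Real.exp (-((u + v * z) * t)))) := by
    refine setLIntegral_congr_fun measurableSet_Ioi fun z hz => ?_
    have hz' : (0:ℝ) < z := hz
    have hr : 0 < u + v * z := by positivity
    have h := aux_gamma 2 (u + v * z) (by norm_num) hr
    have hp : 0 ≤ z ^ (1 - α) := by positivity
    simp only [ENNReal.ofReal_mul hp]
    rw [lintegral_const_mul _ (by fun_prop)]
    congr 1
    rw [Real.Gamma_two, mul_one, one_div, Real.inv_rpow hr.le, ← Real.rpow_neg hr.le] at h
    rw [← h]
    norm_num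
  rw [h1, lintegral_lintegral_swap (by fun_prop)]
  have h2 : ∫⁻ t in Set.Ioi (0:ℝ), ∫⁻ z in Set.Ioi (0:ℝ),
        ENNReal.ofReal (z ^ (1 - α) * (t * Real.exp (-((u + v * z) * t)))) =
      ∫⁻ t in Set.Ioi (0:ℝ), ENNReal.ofReal (Real.Gamma (2 - α) * v ^ (α - 2)) *
        ENNReal.ofReal (t ^ (α - 1) * Real.exp (-(u * t))) := by
    refine setLIntegral_congr_fun measurableSet_Ioi fun t ht => ?_
    have ht' : (0:ℝ) < t := ht
    have hr : 0 < v * t := by positivity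
    have h := aux_gamma (2 - α) (v * t) (by linarith) hr
    have e : ∀ z : ℝ, z ^ (1 - α) * (t * Real.exp (-((u + v * z) * t))) =
        (t * Real.exp (-(u * t))) * (z ^ (2 - α - 1) * Real.exp (-(v * t * z))) := by
      intro z
      rw [show -((u + v * z) * t) = -(u * t) + -(v * t * z) by ring, Real.exp_add,
        show 2 - α - 1 = 1 - α by ring]
      ring
    have hp : 0 ≤ t * Real.exp (-(u * t)) := by positivity
    simp only [e, ENNReal.ofReal_mul hp]
    rw [lintegral_const_mul _ (by fun_prop), h, ← ENNReal.ofReal_mul hp,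
      ← ENNReal.ofReal_mul (by positivity)]
    congr 1
    rw [one_div, Real.inv_rpow hr.le, ← Real.rpow_neg hr.le, Real.mul_rpow hv.le ht'.le,
      show -(2 - α) = α - 2 by ring, show α - 1 = (α - 2) + 1 by ring, Real.rpow_add_one ht'.ne']
    ring
  rw [h2, lintegral_const_mul _ (by fun_prop), aux_gamma α u (by linarith) hu,
    ← ENNReal.ofReal_mul (by positivity)]
  congr 1
  rw [one_div, Real.inv_rpow hu.le, ← Real.rpow_neg hu.le]
  ring

lemma aux_v (α : ℝ) (hα1 : 1 < α) :
    ∫⁻ v in Set.Ioc (0:ℝ) 1, ENNReal.ofReal (v ^ (α - 2) * (1 - v)) =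
      ENNReal.ofReal (1 / (α * (α - 1))) := by
  have i1 : IntervalIntegrable (fun v : ℝ => v ^ (α - 2)) volume 0 1 :=
    intervalIntegral.intervalIntegrable_rpow' (by linarith)
  have i2 : IntervalIntegrable (fun v : ℝ => v ^ (α - 1)) volume 0 1 :=
    intervalIntegral.intervalIntegrable_rpow' (by linarith)
  have e : ∀ v ∈ Set.Ioc (0:ℝ) 1, v ^ (α - 2) - v ^ (α - 1) = v ^ (α - 2) * (1 - v) := by
    intro v hv
    rw [show α - 1 = (α - 2) + 1 by ring, Real.rpow_add_one hv.1.ne']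
    ring
  have hI : ∫ v in (0:ℝ)..1, (v ^ (α - 2) - v ^ (α - 1)) = 1 / (α * (α - 1)) := by
    rw [intervalIntegral.integral_sub i1 i2, integral_rpow (Or.inl (by linarith)),
      integral_rpow (Or.inl (by linarith)), Real.one_rpow, Real.one_rpow,
      Real.zero_rpow (by linarith), Real.zero_rpow (by linarith)]
    have : α - 1 ≠ 0 := by linarith
    have : α ≠ 0 := by linarith
    rw [show α - 2 + 1 = α - 1 by ring, show α - 1 + 1 = α by ring]
    field_simp
    ring
  rw [← hI, intervalIntegral.integral_of_le zero_le_one, ofReal_integral_eq_lintegral_ofReal]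
  · refine setLIntegral_congr_fun measurableSet_Ioc fun v hv => ?_
    simp only [e v hv]
  · exact (intervalIntegrable_iff_integrableOn_Ioc_of_le zero_le_one).1 (i1.sub i2)
  · filter_upwards [ae_restrict_mem measurableSet_Ioc] with v hv
    rw [e v hv]
    exact mul_nonneg (Real.rpow_nonneg hv.1.le _) (by linarith [hv.2])

theorem stmt_0 (α u : ℝ) (hα1 : 1 < α) (hα2 : α < 2) (hu : 0 < u) :
    (α * (α - 1) / Real.Gamma (2 - α)) *
      ∫ z in Set.Ioi (0 : ℝ),
        z ^ (1 - α) * ∫ v in (0 : ℝ)..1, (u + v * z) ^ (-2 : ℝ) * (1 - v) =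
    Real.Gamma α * u ^ (-α) := by
  have hG2 : 0 < Real.Gamma (2 - α) := Real.Gamma_pos_of_pos (by linarith)
  have hG : 0 < Real.Gamma α := Real.Gamma_pos_of_pos (by linarith)
  have ha1 : 0 < α - 1 := by linarith
  have ha : 0 < α := by linarith
  simp only [intervalIntegral.integral_of_le zero_le_one]
  have nn : ∀ z ∈ Set.Ioi (0:ℝ), ∀ v ∈ Set.Ioc (0:ℝ) 1,
      0 ≤ (u + v * z) ^ (-2 : ℝ) * (1 - v) := by
    intro z hz v hv
    have hz' : (0:ℝ) < z := hz
    have := hv.1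
    exact mul_nonneg (by positivity) (by linarith [hv.2])
  have key : ∫ z in Set.Ioi (0 : ℝ),
        z ^ (1 - α) * ∫ v in Set.Ioc (0 : ℝ) 1, (u + v * z) ^ (-2 : ℝ) * (1 - v) =
      Real.Gamma (2 - α) * Real.Gamma α * u ^ (-α) * (1 / (α * (α - 1))) := by
    rw [integral_eq_lintegral_of_nonneg_ae]
    · have h1 : ∫⁻ z in Set.Ioi (0 : ℝ), ENNReal.ofReal
          (z ^ (1 - α) * ∫ v in Set.Ioc (0 : ℝ) 1, (u + v * z) ^ (-2 : ℝ) * (1 - v)) =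
          ∫⁻ z in Set.Ioi (0 : ℝ), ∫⁻ v in Set.Ioc (0 : ℝ) 1,
            ENNReal.ofReal (z ^ (1 - α) * ((u + v * z) ^ (-2 : ℝ) * (1 - v))) := by
        refine setLIntegral_congr_fun measurableSet_Ioi fun z hz => ?_
        have hz' : (0:ℝ) < z := hz
        have hp : 0 ≤ z ^ (1 - α) := by positivity
        simp only [ENNReal.ofReal_mul hp]
        rw [lintegral_const_mul _ (by fun_prop), ofReal_integral_eq_lintegral_ofReal]
        · refine IntegrableOn.mono_set (t := Set.Icc 0 1) ?_ Set.Ioc_subset_Icc_self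
          refine ContinuousOn.integrableOn_Icc ?_
          refine ContinuousOn.mul (ContinuousOn.rpow_const (by fun_prop) ?_) (by fun_prop)
          intro v hv
          have := hv.1
          left
          positivity
        · filter_upwards [ae_restrict_mem measurableSet_Ioc] with v hv using nn z hz v hv
      rw [h1, lintegral_lintegral_swap (by fun_prop)]
      have h2 : ∫⁻ v in Set.Ioc (0 : ℝ) 1, ∫⁻ z in Set.Ioi (0 : ℝ),
            ENNReal.ofReal (z ^ (1 - α) * ((u + v * z) ^ (-2 : ℝ) * (1 - v))) =
          ∫⁻ v in Set.Ioc (0 : ℝ) 1, ENNReal.ofReal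
            (Real.Gamma (2 - α) * Real.Gamma α * u ^ (-α)) *
              ENNReal.ofReal (v ^ (α - 2) * (1 - v)) := by
        refine setLIntegral_congr_fun measurableSet_Ioc fun v hv => ?_
        have hp : 0 ≤ 1 - v := by linarith [hv.2]
        have e : ∀ z : ℝ, z ^ (1 - α) * ((u + v * z) ^ (-2 : ℝ) * (1 - v)) =
          (1 - v) * (z ^ (1 - α) * (u + v * z) ^ (-2 : ℝ)) := fun z => by ring
        simp only [e, ENNReal.ofReal_mul hp]
        rw [lintegral_const_mul _ (by fun_prop), aux_inner α u v hα1 hα2 hu hv.1,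
          ← ENNReal.ofReal_mul hp, ← ENNReal.ofReal_mul (by positivity)]
        congr 1
        ring
      rw [h2, lintegral_const_mul _ (by fun_prop), aux_v α hα1,
        ← ENNReal.ofReal_mul (by positivity), ENNReal.toReal_ofReal (by positivity)]
    · filter_upwards [ae_restrict_mem measurableSet_Ioi] with z hz
      have hz' : (0:ℝ) < z := hz
      exact mul_nonneg (by positivity) (setIntegral_nonneg measurableSet_Ioc (nn z hz))
    · refine AEStronglyMeasurable.mul (by fun_prop) ?_
      refine StronglyMeasurable.aestronglyMeasurable ?_
      refine StronglyMeasurable.integral_prod_right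
        (f := fun z v : ℝ => (u + v * z) ^ (-2 : ℝ) * (1 - v)) ?_
      refine Measurable.stronglyMeasurable ?_
      simp only [Function.uncurry_def]
      fun_prop
  rw [key]
  field_simp
end

section
/- For all real numbers ρ > 0, α with 1 < α < 2, and u > 3, one has ∫_0^∞ K_ρ(u,z) dμ_α(z) = ρ(ρ+1)·u^{−α} · ∫_0^∞ (ln(1+s)/ln u)^2 · (∫_0^1 (1 + v·ln(1+s)/ln u)^{−ρ−2}·(1−v) dv) dμ_α(s). -/
open MeasureTheory

/-- `K_ρ(u,z) := (ln(u+z)/ln u)^{-ρ} + ρ·(ln(u+z)/ln u) − (ρ+1)`. -/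
noncomputable def Kfun (ρ u z : ℝ) : ℝ :=
  (Real.log (u + z) / Real.log u) ^ (-ρ) + ρ * (Real.log (u + z) / Real.log u) - (ρ + 1)

/-- The `α`-stable measure on `(0,∞)` with density
`z ↦ (α(α−1)/Γ(2−α))·z^{−1−α}` with respect to Lebesgue measure. -/
noncomputable def muAlpha (α : ℝ) : Measure ℝ :=
  (volume.withDensity
    (fun z => ENNReal.ofReal ((α * (α - 1) / Real.Gamma (2 - α)) * z ^ (-1 - α)))).restrict
    (Set.Ioi 0)


lemma mu_int (α : ℝ) (hα1 : 1 < α) (hα2 : α < 2) (f : ℝ → ℝ) :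
    ∫ z in Set.Ioi (0 : ℝ), f z ∂(muAlpha α) =
      ∫ z in Set.Ioi (0 : ℝ), ((α * (α - 1) / Real.Gamma (2 - α)) * z ^ (-1 - α)) * f z := by
  unfold muAlpha
  rw [Measure.restrict_restrict measurableSet_Ioi, Set.inter_self,
    setIntegral_withDensity_eq_setIntegral_toReal_smul]
  · apply setIntegral_congr_fun measurableSet_Ioi
    intro z hz
    have hz : (0 : ℝ) < z := hz
    have hG : 0 < Real.Gamma (2 - α) := Real.Gamma_pos_of_pos (by linarith)
    have h1 : 0 < α - 1 := by linarith
    have h0 : 0 < α := by linarith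
    simp only [smul_eq_mul]
    rw [ENNReal.toReal_ofReal (by positivity)]
  · exact ENNReal.measurable_ofReal.comp (by fun_prop)
  · exact Filter.Eventually.of_forall fun x => ENNReal.ofReal_lt_top
  · exact measurableSet_Ioi

lemma taylor_K (ρ x : ℝ) (hx : 0 ≤ x) :
    (1 + x) ^ (-ρ) + ρ * (1 + x) - (ρ + 1) =
      ρ * (ρ + 1) * (x ^ 2 * ∫ v in (0 : ℝ)..1, (1 + v * x) ^ (-ρ - 2) * (1 - v)) := by
  have hpos : ∀ v ∈ Set.uIcc (0 : ℝ) 1, 0 < 1 + v * x := by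
    intro v hv
    rw [Set.uIcc_of_le zero_le_one] at hv
    have := mul_nonneg hv.1 hx
    linarith
  have hd : ∀ v ∈ Set.uIcc (0 : ℝ) 1, HasDerivAt
      (fun v : ℝ => (1 - v) * (-ρ * x * (1 + v * x) ^ (-ρ - 1)) + (1 + v * x) ^ (-ρ))
      (ρ * (ρ + 1) * x ^ 2 * ((1 + v * x) ^ (-ρ - 2) * (1 - v))) v := by
    intro v hv
    have h0 := hpos v hv
    have hl : HasDerivAt (fun v : ℝ => 1 + v * x) x v := by
      simpa using ((hasDerivAt_id v).mul_const x).const_add 1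
    have h1 := hl.rpow_const (p := -ρ - 1) (Or.inl h0.ne')
    have h2 := hl.rpow_const (p := -ρ) (Or.inl h0.ne')
    have h3 : HasDerivAt (fun v : ℝ => 1 - v) (-1) v := by
      simpa using (hasDerivAt_id v).const_sub 1
    have h4 := (h3.mul (h1.const_mul (-ρ * x))).add h2
    refine h4.congr_deriv ?_
    rw [show -ρ - 1 - 1 = -ρ - 2 by ring]
    ring
  have hi := intervalIntegral.integral_eq_sub_of_hasDerivAt hd (by
    apply ContinuousOn.intervalIntegrable
    apply ContinuousOn.mul continuousOn_const
    apply ContinuousOn.mul _ (by fun_prop)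
    apply ContinuousOn.rpow_const (by fun_prop)
    intro v hv
    exact Or.inl (hpos v hv).ne')
  rw [intervalIntegral.integral_const_mul] at hi
  rw [← mul_assoc, hi]
  simp
  ring

theorem stmt_3 (ρ α u : ℝ) (hρ : 0 < ρ) (hα1 : 1 < α) (hα2 : α < 2) (hu : 3 < u) :
    ∫ z in Set.Ioi (0 : ℝ), Kfun ρ u z ∂(muAlpha α) =
      ρ * (ρ + 1) * u ^ (-α) *
        ∫ s in Set.Ioi (0 : ℝ),
          (Real.log (1 + s) / Real.log u) ^ 2 *
            (∫ v in (0 : ℝ)..1,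
              (1 + v * Real.log (1 + s) / Real.log u) ^ (-ρ - 2) * (1 - v)) ∂(muAlpha α) := by
  rw [mu_int α hα1 hα2, mu_int α hα1 hα2]
  have hu0 : 0 < u := by linarith
  have hlog : 0 < Real.log u := Real.log_pos (by linarith)
  have hsub := integral_comp_mul_left_Ioi
    (fun z => α * (α - 1) / Real.Gamma (2 - α) * z ^ (-1 - α) * Kfun ρ u z) 0 hu0
  rw [mul_zero, smul_eq_mul, eq_inv_mul_iff_mul_eq₀ hu0.ne'] at hsub
  rw [← hsub, ← integral_const_mul, ← integral_const_mul]
  apply setIntegral_congr_fun measurableSet_Ioi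
  intro s hs
  have hs : (0 : ℝ) < s := hs
  have hK : Kfun ρ u (u * s) = ρ * (ρ + 1) * ((Real.log (1 + s) / Real.log u) ^ 2 *
      ∫ v in (0 : ℝ)..1, (1 + v * (Real.log (1 + s) / Real.log u)) ^ (-ρ - 2) * (1 - v)) := by
    unfold Kfun
    rw [show u + u * s = u * (1 + s) by ring, Real.log_mul hu0.ne' (by positivity), add_div,
      div_self hlog.ne']
    exact taylor_K ρ (Real.log (1 + s) / Real.log u)
      (div_nonneg (Real.log_nonneg (by linarith)) hlog.le)
  have hp : u ^ (-α) = u * u ^ (-1 - α) := by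
    rw [show -α = 1 + (-1 - α) by ring, Real.rpow_add hu0, Real.rpow_one]
  simp only [hK, mul_div_assoc]
  rw [Real.mul_rpow hu0.le hs.le, hp]
  ring
end

section
/- For all real numbers ρ > 0, u > 3 and z > 0, one has K_ρ(u,z) ≤ (ρ(ρ+1)/2) · (ln(1+z)/ln u)^2. -/
lemma aux_bern (q s : ℝ) (hq : 0 < q) (hs : 0 ≤ s) : 1 - q * s ≤ (1 + s) ^ (-q) := by
  rw [Real.rpow_def_of_pos (by linarith)]
  have h1 := Real.add_one_le_exp (Real.log (1 + s) * -q)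
  have h2 := Real.log_le_sub_one_of_pos (show 0 < 1 + s by linarith)
  nlinarith

lemma aux_main (ρ s : ℝ) (hρ : 0 < ρ) (hs : 0 ≤ s) :
    (1 + s) ^ (-ρ) ≤ 1 - ρ * s + ρ * (ρ + 1) / 2 * s ^ 2 := by
  have hd : ∀ x : ℝ, 0 ≤ x → HasDerivAt
      (fun x : ℝ => 1 - ρ * x + ρ * (ρ + 1) / 2 * x ^ 2 - (1 + x) ^ (-ρ))
      (-ρ + ρ * (ρ + 1) * x + ρ * (1 + x) ^ (-(ρ + 1))) x := by
    intro x hx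
    have h1 : HasDerivAt (fun x : ℝ => 1 + x) 1 x := (hasDerivAt_id x).const_add 1
    have h2 := h1.rpow_const (p := -ρ) (Or.inl (by linarith))
    have h3 := (((hasDerivAt_id x).const_mul ρ).const_sub 1).add
      (((hasDerivAt_id x).pow 2).const_mul (ρ * (ρ + 1) / 2))
    have h4 := h3.sub h2
    refine HasDerivAt.congr_deriv h4 ?_
    rw [show -ρ - 1 = -(ρ + 1) by ring]
    simp
    ring
  have hm : MonotoneOn
      (fun x : ℝ => 1 - ρ * x + ρ * (ρ + 1) / 2 * x ^ 2 - (1 + x) ^ (-ρ)) (Set.Ici 0) := by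
    apply monotoneOn_of_deriv_nonneg (convex_Ici 0)
    · intro x hx
      exact (hd x hx).continuousAt.continuousWithinAt
    · intro x hx
      rw [interior_Ici] at hx
      exact (hd x (le_of_lt hx)).differentiableAt.differentiableWithinAt
    · intro x hx
      rw [interior_Ici] at hx
      have hx' : 0 ≤ x := le_of_lt hx
      rw [(hd x hx').deriv]
      have := aux_bern (ρ + 1) x (by linarith) hx'
      nlinarith
  have := hm (Set.mem_Ici.2 le_rfl) (Set.mem_Ici.2 hs) hs
  simp at this
  linarith

theorem stmt_7 (ρ u z : ℝ) (hρ : 0 < ρ) (hu : 3 < u) (hz : 0 < z) :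
    Kfun ρ u z ≤ (ρ * (ρ + 1) / 2) * (Real.log (1 + z) / Real.log u) ^ 2 := by
  have hL : 0 < Real.log u := Real.log_pos (by linarith)
  obtain ⟨s, hs⟩ : ∃ s, s = Real.log (u + z) / Real.log u - 1 := ⟨_, rfl⟩
  have ht : Real.log (u + z) / Real.log u = 1 + s := by linarith
  have hs0 : 0 ≤ s := by
    have : 1 ≤ Real.log (u + z) / Real.log u := by
      rw [le_div_iff₀ hL, one_mul]
      exact Real.log_le_log (by linarith) (by linarith)
    linarith
  have hs1 : s ≤ Real.log (1 + z) / Real.log u := by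
    have h : Real.log (u + z) ≤ Real.log (1 + z) + Real.log u := by
      rw [← Real.log_mul (by linarith) (by linarith)]
      exact Real.log_le_log (by linarith) (by nlinarith)
    rw [hs, sub_le_iff_le_add, div_le_iff₀ hL, add_mul, div_mul_cancel₀ _ hL.ne']
    linarith
  have h1 := aux_main ρ s hρ hs0
  have h2 : ρ * (ρ + 1) / 2 * s ^ 2 ≤
      ρ * (ρ + 1) / 2 * (Real.log (1 + z) / Real.log u) ^ 2 := by gcongr
  unfold Kfun
  rw [ht]
  linarith
end

section
/- Let ρ > 0, 1 < α < 2, b_1 ≥ 0, b_2 ≥ 0 and r_1, r_2 real with r_1 ≤ 2 and r_2 ≤ α. Define H_ρ(u) := (1/2)·b_1·u^{r_1−2} + b_2·u^{r_2} · ∫_0^∞ K_ρ(u,z) dμ_α(z) for u > 3. Then there exists a constant M such that H_ρ(u) ≤ M for all u > 3; in particular limsup_{u→∞} H_ρ(u) < ∞. -/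
open MeasureTheory

theorem K_bounds (ρ u z : ℝ) (hρ : 0 < ρ) (hu : 3 < u) (hz : 0 < z) :
    0 ≤ Kfun ρ u z ∧ Kfun ρ u z ≤ ρ * (z / u) ∧ Kfun ρ u z ≤ (ρ + ρ ^ 2) * (z / u) ^ 2 := by
  have hl : 1 ≤ Real.log u := by
    rw [Real.le_log_iff_exp_le (by linarith)]
    linarith [Real.exp_one_lt_d9]
  have hzu : 0 < z / u := by positivity
  have hsum : Real.log (u + z) = Real.log u + Real.log (1 + z / u) := by
    rw [← Real.log_mul (by positivity) (by positivity)]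
    congr 1
    field_simp
  obtain ⟨y, hy⟩ : ∃ y, y = Real.log (1 + z / u) / Real.log u := ⟨_, rfl⟩
  have hx : Real.log (u + z) / Real.log u = 1 + y := by
    rw [hsum, hy]; field_simp
  have hlog0 : 0 ≤ Real.log (1 + z / u) := Real.log_nonneg (by linarith)
  have hlog1 : Real.log (1 + z / u) ≤ z / u := by
    have := Real.log_le_sub_one_of_pos (show 0 < 1 + z / u by positivity)
    linarith
  have hy0 : 0 ≤ y := by rw [hy]; positivity
  have hy1 : y ≤ z / u := by
    rw [hy]; exact (div_le_self hlog0 hl).trans hlog1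
  have hL1 : Real.log (1 + y) ≤ y := by
    have := Real.log_le_sub_one_of_pos (show 0 < 1 + y by positivity)
    linarith
  have hL2 : y - y ^ 2 ≤ Real.log (1 + y) := by
    have h1 := Real.one_sub_inv_le_log_of_pos (show 0 < 1 + y by positivity)
    have h2 : (1 + y)⁻¹ ≤ 1 - y + y ^ 2 := by
      rw [inv_le_iff_one_le_mul₀ (by positivity)]
      have := pow_nonneg hy0 3
      nlinarith
    linarith
  have hL0 : 0 ≤ Real.log (1 + y) := Real.log_nonneg (by linarith)
  have hK : Kfun ρ u z = Real.exp (-(ρ * Real.log (1 + y))) + ρ * y - 1 := by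
    unfold Kfun
    rw [hx, Real.rpow_def_of_pos (by positivity)]
    ring_nf
  obtain ⟨s, hs⟩ : ∃ s, s = ρ * Real.log (1 + y) := ⟨_, rfl⟩
  have hs0 : 0 ≤ s := by rw [hs]; positivity
  have hs1 : s ≤ ρ * y := by rw [hs]; gcongr
  have hs2 : ρ * (y - y ^ 2) ≤ s := by rw [hs]; gcongr
  rw [← hs] at hK
  have he0 := Real.add_one_le_exp (-s)
  have he1 : Real.exp (-s) ≤ 1 := Real.exp_le_one_iff.2 (by linarith)
  have he2 : Real.exp (-s) ≤ 1 - s + s ^ 2 := by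
    rw [Real.exp_neg]
    have h := Real.add_one_le_exp s
    have : (Real.exp s)⁻¹ ≤ (s + 1)⁻¹ := by gcongr
    refine this.trans ?_
    rw [inv_le_iff_one_le_mul₀ (by positivity)]
    have := pow_nonneg hs0 3
    nlinarith
  refine ⟨by linarith, ?_, ?_⟩
  · have : ρ * y ≤ ρ * (z / u) := by gcongr
    linarith
  · have h1 : (ρ + ρ ^ 2) * y ^ 2 ≤ (ρ + ρ ^ 2) * (z / u) ^ 2 := by gcongr
    have h2 : s ^ 2 ≤ (ρ * y) ^ 2 := by gcongr
    nlinarith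

theorem int_eq (ρ α u : ℝ) (hα1 : 1 < α) (hα2 : α < 2) :
    ∫ z in Set.Ioi (0 : ℝ), Kfun ρ u z ∂(muAlpha α)
      = ∫ z in Set.Ioi (0 : ℝ), ((α * (α - 1) / Real.Gamma (2 - α)) * z ^ (-1 - α)) * Kfun ρ u z := by
  have hc : 0 ≤ α * (α - 1) / Real.Gamma (2 - α) := by
    have := Real.Gamma_pos_of_pos (show 0 < 2 - α by linarith)
    have : 0 < α - 1 := by linarith
    positivity
  unfold muAlpha
  rw [Measure.restrict_restrict measurableSet_Ioi, Set.inter_self,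
    setIntegral_withDensity_eq_setIntegral_toReal_smul (by fun_prop) (by simp) _ measurableSet_Ioi]
  refine setIntegral_congr_fun measurableSet_Ioi fun z hz => ?_
  have hz : 0 < z := hz
  simp only [smul_eq_mul]
  rw [ENNReal.toReal_ofReal (by positivity)]

theorem int_bound (ρ α u : ℝ) (hρ : 0 < ρ) (hα1 : 1 < α) (hα2 : α < 2) (hu : 3 < u) :
    ∫ z in Set.Ioi (0 : ℝ), Kfun ρ u z ∂(muAlpha α)
      ≤ (α * (α - 1) / Real.Gamma (2 - α)) * ((ρ + ρ ^ 2) / (2 - α) + ρ / (α - 1)) * u ^ (-α) := by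
  have hu0 : 0 < u := by linarith
  rw [int_eq ρ α u hα1 hα2]
  obtain ⟨c, hcd⟩ : ∃ c, c = α * (α - 1) / Real.Gamma (2 - α) := ⟨_, rfl⟩
  have hc : 0 ≤ c := by
    have := Real.Gamma_pos_of_pos (show 0 < 2 - α by linarith)
    have : 0 < α - 1 := by linarith
    rw [hcd]
    positivity
  rw [← hcd]
  let g1 : ℝ → ℝ := fun z => (c * (ρ + ρ ^ 2) / u ^ 2) * z ^ (1 - α)
  let g2 : ℝ → ℝ := fun z => (c * ρ / u) * z ^ (-α)
  have i1 : IntegrableOn g1 (Set.Ioc 0 u) := by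
    have := (intervalIntegral.intervalIntegrable_rpow' (a := 0) (b := u)
      (show -1 < 1 - α by linarith))
    rw [intervalIntegrable_iff_integrableOn_Ioc_of_le hu0.le] at this
    exact this.const_mul _
  have i2 : IntegrableOn g2 (Set.Ioi u) :=
    (integrableOn_Ioi_rpow_of_lt (show -α < -1 by linarith) hu0).const_mul _
  have v1 : ∫ z in Set.Ioc 0 u, g1 z = c * (ρ + ρ ^ 2) / (2 - α) * u ^ (-α) := by
    simp only [g1]
    rw [integral_const_mul, ← intervalIntegral.integral_of_le hu0.le,
      integral_rpow (Or.inl (by linarith)), Real.zero_rpow (by linarith),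
      show 1 - α + 1 = (2:ℕ) + -α by push_cast; ring, Real.rpow_add hu0, Real.rpow_natCast]
    push_cast
    have : (2:ℝ) + -α ≠ 0 := by linarith
    have : (2:ℝ) - α ≠ 0 := by linarith
    rw [← sub_eq_add_neg]
    field_simp
    ring
  have v2 : ∫ z in Set.Ioi u, g2 z = c * ρ / (α - 1) * u ^ (-α) := by
    simp only [g2]
    rw [integral_const_mul, integral_Ioi_rpow_of_lt (by linarith) hu0, Real.rpow_add hu0,
      Real.rpow_one]
    have h1 : α - 1 ≠ 0 := by linarith
    rw [show -α + 1 = -(α - 1) by ring]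
    field_simp
  let g : ℝ → ℝ := fun z => if z ≤ u then g1 z else g2 z
  have e1 : Set.EqOn g1 g (Set.Ioc 0 u) := fun z hz => by simp [g, hz.2]
  have e2 : Set.EqOn g2 g (Set.Ioi u) := fun z hz => by
    have : u < z := hz
    simp [g, this]
  have j1 := i1.congr_fun e1 measurableSet_Ioc
  have j2 := i2.congr_fun e2 measurableSet_Ioi
  have hun : Set.Ioc 0 u ∪ Set.Ioi u = Set.Ioi 0 := Set.Ioc_union_Ioi_eq_Ioi hu0.le
  have ig : IntegrableOn g (Set.Ioi 0) := by rw [← hun]; exact j1.union j2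
  have vg : ∫ z in Set.Ioi 0, g z
      = c * ((ρ + ρ ^ 2) / (2 - α) + ρ / (α - 1)) * u ^ (-α) := by
    rw [← hun, setIntegral_union (Set.Ioc_disjoint_Ioi le_rfl) measurableSet_Ioi j1 j2,
      ← setIntegral_congr_fun measurableSet_Ioc e1, ← setIntegral_congr_fun measurableSet_Ioi e2,
      v1, v2]
    ring
  rw [← vg]
  refine integral_mono_of_nonneg ?_ ig ?_
  · refine (ae_restrict_iff' measurableSet_Ioi).2 (Filter.Eventually.of_forall fun z hz => ?_)
    have hz : 0 < z := hz
    have := (K_bounds ρ u z hρ hu hz).1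
    simp only [Pi.zero_apply]
    positivity
  · refine (ae_restrict_iff' measurableSet_Ioi).2 (Filter.Eventually.of_forall fun z hz => ?_)
    have hz : 0 < z := hz
    obtain ⟨-, h1, h2⟩ := K_bounds ρ u z hρ hu hz
    simp only [g]
    split_ifs
    · calc c * z ^ (-1 - α) * Kfun ρ u z
          ≤ c * z ^ (-1 - α) * ((ρ + ρ ^ 2) * (z / u) ^ 2) := by gcongr
        _ = g1 z := by
          simp only [g1]
          rw [show 1 - α = (-1 - α) + (2:ℕ) by push_cast; ring, Real.rpow_add hz,
            Real.rpow_natCast]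
          field_simp
    · calc c * z ^ (-1 - α) * Kfun ρ u z
          ≤ c * z ^ (-1 - α) * (ρ * (z / u)) := by gcongr
        _ = g2 z := by
          simp only [g2]
          rw [show -α = (-1 - α) + 1 by ring, Real.rpow_add hz, Real.rpow_one]
          rw [show -1 - α = -1 - α from rfl]
          field_simp

theorem stmt_10 (ρ α b₁ b₂ r₁ r₂ : ℝ) (hρ : 0 < ρ) (hα1 : 1 < α) (hα2 : α < 2)
    (hb₁ : 0 ≤ b₁) (hb₂ : 0 ≤ b₂) (hr₁ : r₁ ≤ 2) (hr₂ : r₂ ≤ α) :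
    ∃ M : ℝ, ∀ u : ℝ, 3 < u →
      (1 / 2) * b₁ * u ^ (r₁ - 2)
          + b₂ * u ^ r₂ * (∫ z in Set.Ioi (0 : ℝ), Kfun ρ u z ∂(muAlpha α)) ≤ M := by
  obtain ⟨C, hC⟩ : ∃ C, C = (α * (α - 1) / Real.Gamma (2 - α)) *
    ((ρ + ρ ^ 2) / (2 - α) + ρ / (α - 1)) := ⟨_, rfl⟩
  have hC0 : 0 ≤ C := by
    have := Real.Gamma_pos_of_pos (show 0 < 2 - α by linarith)
    have : 0 < α - 1 := by linarith
    have : 0 < 2 - α := by linarith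
    rw [hC]
    positivity
  refine ⟨(1 / 2) * b₁ * 1 + b₂ * C * 1, fun u hu => ?_⟩
  have hu0 : 0 < u := by linarith
  have h := int_bound ρ α u hρ hα1 hα2 hu
  rw [← hC] at h
  have h1 : u ^ (r₁ - 2) ≤ 1 := Real.rpow_le_one_of_one_le_of_nonpos (by linarith) (by linarith)
  have h2 : u ^ (r₂ + -α) ≤ 1 := Real.rpow_le_one_of_one_le_of_nonpos (by linarith) (by linarith)
  refine add_le_add (by gcongr) ?_
  calc _ ≤ b₂ * u ^ r₂ * (C * u ^ (-α)) := by gcongr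
    _ = b₂ * C * u ^ (r₂ + -α) := by rw [Real.rpow_add hu0]; ring
    _ ≤ _ := by gcongr
end

section
/- Let ρ > 0, let U ⊆ (0,∞) be a Borel set, let μ be a σ-finite Borel measure on U with ∫_U min(z,z^2) μ(dz) < ∞, let ν be a σ-finite Borel measure on (0,∞)∖U with ∫ max(1, ln(1+z)) ν(dz) < ∞, let a_0 : (0,∞) → ℝ and a_1, a_2, a_3 : (0,∞) → [0,∞) be functions, and let g(x) := (ln x)^{−ρ}. Then for every u > 3, Lg(u) = ρ·(ln u)^{−ρ−1}·φ(u) + (1/2)·ρ(ρ+1)·(ln u)^{−2}·a_1(u)·u^{−2}·g(u) + g(u)·a_2(u)·∫_U K_ρ(u,z) μ(dz) + g(u)·a_3(u)·∫_{(0,∞)∖U} K_ρ(u,z) ν(dz). -/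
open MeasureTheory

/-- The generator
`Lg(u) = a₀(u)g′(u) + ½a₁(u)g″(u) + a₂(u)∫_U [g(u+z)−g(u)−zg′(u)] μ(dz)
  + a₃(u)∫_{(0,∞)∖U} [g(u+z)−g(u)] ν(dz)`. -/
noncomputable def Lop (U : Set ℝ) (μ ν : Measure ℝ) (a₀ a₁ a₂ a₃ : ℝ → ℝ)
    (g : ℝ → ℝ) (u : ℝ) : ℝ :=
  a₀ u * deriv g u + (1 / 2) * a₁ u * deriv (deriv g) u
    + a₂ u * (∫ z in U, (g (u + z) - g u - z * deriv g u) ∂μ)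
    + a₃ u * (∫ z in Set.Ioi (0 : ℝ) \ U, (g (u + z) - g u) ∂ν)

/-- The function
`φ(u) = −a₀(u)u⁻¹ + ½a₁(u)u⁻² + a₂(u)∫_U z²(∫₀¹ (u+vz)⁻²(1−v) dv) μ(dz)
  − a₃(u)∫_{(0,∞)∖U} z(∫₀¹ (u+vz)⁻¹ dv) ν(dz)`. -/
noncomputable def phiFun (U : Set ℝ) (μ ν : Measure ℝ) (a₀ a₁ a₂ a₃ : ℝ → ℝ) (u : ℝ) : ℝ :=
  -a₀ u * u ^ (-1 : ℝ) + (1 / 2) * a₁ u * u ^ (-2 : ℝ)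
    + a₂ u * (∫ z in U, z ^ 2 * (∫ v in (0 : ℝ)..1, (u + v * z) ^ (-2 : ℝ) * (1 - v)) ∂μ)
    - a₃ u * (∫ z in Set.Ioi (0 : ℝ) \ U, z * (∫ v in (0 : ℝ)..1, (u + v * z) ^ (-1 : ℝ)) ∂ν)

/-- `H_ρ(u) = ½a₁(u)u⁻² + a₂(u)∫_U K_ρ(u,z) μ(dz) + a₃(u)∫_{(0,∞)∖U} K_ρ(u,z) ν(dz)`. -/
noncomputable def Hfun (ρ : ℝ) (U : Set ℝ) (μ ν : Measure ℝ) (a₁ a₂ a₃ : ℝ → ℝ) (u : ℝ) : ℝ :=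
  (1 / 2) * a₁ u * u ^ (-2 : ℝ) + a₂ u * (∫ z in U, Kfun ρ u z ∂μ)
    + a₃ u * (∫ z in Set.Ioi (0 : ℝ) \ U, Kfun ρ u z ∂ν)

theorem aux_D (u z : ℝ) (hu : 3 < u) (hz : 0 < z) :
    0 ≤ Real.log (u + z) - Real.log u ∧ Real.log (u + z) - Real.log u ≤ z / u ∧
    Real.log (u + z) - Real.log u ≤ Real.log (1 + z) ∧
    z / u - (Real.log (u + z) - Real.log u) ≤ z ^ 2 ∧ z / u ≤ z := by
  have hu0 : 0 < u := by linarith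
  have ht : 0 < z / u := by positivity
  have htz : z / u ≤ z := div_le_self hz.le (by linarith)
  have hD : Real.log (u + z) - Real.log u = Real.log (1 + z / u) := by
    rw [← Real.log_div (by positivity) (by positivity)]
    congr 1
    field_simp
  rw [hD]
  refine ⟨Real.log_nonneg (by linarith), ?_, ?_, ?_, htz⟩
  · have := Real.log_le_sub_one_of_pos (show 0 < 1 + z / u by positivity)
    linarith
  · exact Real.log_le_log (by positivity) (by linarith)
  · have h1 := Real.one_sub_inv_le_log_of_pos (show 0 < 1 + z / u by positivity)
    have h2 : 1 - (1 + z / u)⁻¹ ≥ z / u - (z / u) ^ 2 := by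
      have h3 : (1 + z / u)⁻¹ ≤ 1 - z / u + (z / u) ^ 2 := by
        rw [inv_le_iff_one_le_mul₀ (by positivity)]
        nlinarith [pow_pos ht 3]
      linarith
    have h4 : (z / u) ^ 2 ≤ z ^ 2 := by gcongr
    linarith

theorem aux_r (ρ r : ℝ) (hρ : 0 < ρ) (hr : 1 ≤ r) :
    0 ≤ r ^ (-ρ) + ρ * r - (ρ + 1) ∧ r ^ (-ρ) + ρ * r - (ρ + 1) ≤ ρ * (r - 1) ∧
    r ^ (-ρ) + ρ * r - (ρ + 1) ≤ (ρ + ρ ^ 2) * (r - 1) ^ 2 := by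
  have hr0 : 0 < r := by linarith
  have hL : Real.log r ≤ r - 1 := Real.log_le_sub_one_of_pos hr0
  have hL0 : 0 ≤ Real.log r := Real.log_nonneg hr
  have hL1 := Real.one_sub_inv_le_log_of_pos hr0
  have hL2 : r⁻¹ ≤ 1 - (r - 1) + (r - 1) ^ 2 := by
    rw [inv_le_iff_one_le_mul₀ hr0]
    nlinarith [pow_nonneg (sub_nonneg.2 hr) 3]
  rw [Real.rpow_def_of_pos hr0]
  have e1 := Real.add_one_le_exp (Real.log r * -ρ)
  refine ⟨by nlinarith, ?_, ?_⟩
  · have : Real.exp (Real.log r * -ρ) ≤ 1 := Real.exp_le_one_iff.2 (by nlinarith)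
    linarith
  · set x := ρ * Real.log r with hx
    have hx0 : 0 ≤ x := by positivity
    have e2 : Real.exp (Real.log r * -ρ) ≤ 1 - x + x ^ 2 := by
      rw [show Real.log r * -ρ = -x by rw [hx]; ring, Real.exp_neg]
      have e3 := Real.add_one_le_exp x
      calc (Real.exp x)⁻¹ ≤ (x + 1)⁻¹ := by gcongr
        _ ≤ _ := by
          rw [inv_le_iff_one_le_mul₀ (by positivity)]
          nlinarith [pow_nonneg hx0 3]
    have e4 : x ^ 2 ≤ ρ ^ 2 * (r - 1) ^ 2 := by
      rw [hx, mul_pow]; gcongr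
    have e5 : ρ * (r - 1 - Real.log r) ≤ ρ * (r - 1) ^ 2 := by
      apply mul_le_mul_of_nonneg_left _ hρ.le
      linarith
    rw [hx] at e2 e4
    linarith

theorem aux_K (ρ u z : ℝ) (hρ : 0 < ρ) (hu : 3 < u) (hz : 0 < z) :
    0 ≤ Kfun ρ u z ∧ Kfun ρ u z ≤ ρ * Real.log (1 + z) ∧
    Kfun ρ u z ≤ (ρ + ρ ^ 2) * min z (z ^ 2) := by
  obtain ⟨d0, d1, d2, -, d4⟩ := aux_D u z hu hz
  have hl : 1 < Real.log u := by
    rw [Real.lt_log_iff_exp_lt (by linarith)]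
    linarith [Real.exp_one_lt_d9]
  have hr : Real.log (u + z) / Real.log u - 1 = (Real.log (u + z) - Real.log u) / Real.log u := by
    field_simp
  have hr0 : 0 ≤ Real.log (u + z) / Real.log u - 1 := by rw [hr]; positivity
  have hr1 : Real.log (u + z) / Real.log u - 1 ≤ Real.log (u + z) - Real.log u := by
    rw [hr]; exact div_le_self d0 hl.le
  obtain ⟨k0, k1, k2⟩ := aux_r ρ (Real.log (u + z) / Real.log u) hρ (by linarith)
  unfold Kfun
  have h1 : ρ * (Real.log (u + z) / Real.log u - 1) ≤ ρ * (Real.log (u + z) - Real.log u) := by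
    gcongr
  refine ⟨k0, k1.trans (h1.trans (by gcongr)), ?_⟩
  rw [mul_min_of_nonneg _ _ (by positivity)]
  refine le_min ?_ (k2.trans ?_)
  · have : ρ * (Real.log (u + z) - Real.log u) ≤ ρ * z :=
      mul_le_mul_of_nonneg_left (by linarith) hρ.le
    nlinarith [mul_pos (pow_pos hρ 2) hz]
  · gcongr
    linarith

theorem aux_deriv (ρ x : ℝ) (hx : 1 < x) :
    HasDerivAt (fun x => Real.log x ^ (-ρ)) (-ρ * Real.log x ^ (-ρ - 1) / x) x := by
  have hl := Real.log_pos hx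
  have := (Real.hasDerivAt_log (show x ≠ 0 by linarith)).rpow_const (p := -ρ) (Or.inl hl.ne')
  convert this using 1
  field_simp

theorem aux_deriv2 (ρ x : ℝ) (hx : 1 < x) :
    HasDerivAt (fun x => -ρ * Real.log x ^ (-ρ - 1) / x)
      (ρ * (ρ + 1) * Real.log x ^ (-ρ - 2) / x ^ 2 + ρ * Real.log x ^ (-ρ - 1) / x ^ 2) x := by
  have h := ((aux_deriv (ρ + 1) x hx).const_mul (-ρ)).div (hasDerivAt_id x) (by simp; linarith)
  have e1 : -(ρ + 1) = -ρ - 1 := by ring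
  have e2 : -ρ - 1 - 1 = -ρ - 2 := by ring
  rw [e1, e2] at h
  refine HasDerivAt.congr_deriv (f := fun x => -ρ * Real.log x ^ (-ρ - 1) / x) h ?_
  simp only [id]
  have : x ≠ 0 := by linarith
  field_simp
  ring

theorem aux_int1 (u z : ℝ) (hu : 3 < u) (hz : 0 < z) :
    z * (∫ v in (0 : ℝ)..1, (u + v * z) ^ (-1 : ℝ)) = Real.log (u + z) - Real.log u := by
  have hpos : ∀ v ∈ Set.uIcc (0 : ℝ) 1, 0 < u + v * z := by
    intro v hv
    rw [Set.uIcc_of_le zero_le_one] at hv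
    have := mul_nonneg hv.1 hz.le
    linarith
  rw [← intervalIntegral.integral_const_mul]
  rw [intervalIntegral.integral_eq_sub_of_hasDerivAt (f := fun v => Real.log (u + v * z))]
  · simp
  · intro v hv
    have h := (((hasDerivAt_id v).mul_const z).const_add u).log (hpos v hv).ne'
    refine HasDerivAt.congr_deriv (f := fun v => Real.log (u + v * z)) h ?_
    rw [Real.rpow_neg_one]
    simp [mul_comm, div_eq_mul_inv]
  · apply ContinuousOn.intervalIntegrable
    apply continuousOn_const.mul
    exact ContinuousOn.rpow_const (by fun_prop) (fun v hv => Or.inl (hpos v hv).ne')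

theorem aux_int2 (u z : ℝ) (hu : 3 < u) (hz : 0 < z) :
    z ^ 2 * (∫ v in (0 : ℝ)..1, (u + v * z) ^ (-2 : ℝ) * (1 - v)) =
      z / u - (Real.log (u + z) - Real.log u) := by
  have hpos : ∀ v ∈ Set.uIcc (0 : ℝ) 1, 0 < u + v * z := by
    intro v hv
    rw [Set.uIcc_of_le zero_le_one] at hv
    have := mul_nonneg hv.1 hz.le
    linarith
  rw [← intervalIntegral.integral_const_mul]
  rw [intervalIntegral.integral_eq_sub_of_hasDerivAt
    (f := fun v => -(z * (1 - v) / (u + v * z)) - Real.log (u + v * z))]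
  · simp
    ring
  · intro v hv
    have hp := hpos v hv
    have h0 := ((hasDerivAt_id v).mul_const z).const_add u
    have h1 := h0.log hp.ne'
    have h2 := ((((hasDerivAt_id v).const_sub 1).const_mul z).div h0 hp.ne').neg.sub h1
    refine HasDerivAt.congr_deriv
      (f := fun v => -(z * (1 - v) / (u + v * z)) - Real.log (u + v * z)) h2 ?_
    rw [show (-2 : ℝ) = -((2 : ℕ) : ℝ) by norm_num, Real.rpow_neg hp.le, Real.rpow_natCast]
    simp only [id]
    field_simp
    ring
  · apply ContinuousOn.intervalIntegrable
    apply continuousOn_const.mul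
    exact (ContinuousOn.rpow_const (by fun_prop) (fun v hv => Or.inl (hpos v hv).ne')).mul
      (by fun_prop)

theorem stmt_14 (ρ : ℝ) (hρ : 0 < ρ) (U : Set ℝ) (hU : MeasurableSet U)
    (hUsub : U ⊆ Set.Ioi 0) (μ ν : Measure ℝ) [SigmaFinite μ] [SigmaFinite ν]
    (hμ : Integrable (fun z => min z (z ^ 2)) (μ.restrict U))
    (hν : Integrable (fun z => max 1 (Real.log (1 + z))) (ν.restrict (Set.Ioi 0 \ U)))
    (a₀ a₁ a₂ a₃ : ℝ → ℝ) (ha₁ : ∀ u, 0 < u → 0 ≤ a₁ u) (ha₂ : ∀ u, 0 < u → 0 ≤ a₂ u)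
    (ha₃ : ∀ u, 0 < u → 0 ≤ a₃ u)
    (g : ℝ → ℝ) (hg : ∀ x, g x = Real.log x ^ (-ρ)) :
    ∀ u : ℝ, 3 < u →
      Lop U μ ν a₀ a₁ a₂ a₃ g u =
        ρ * Real.log u ^ (-ρ - 1) * phiFun U μ ν a₀ a₁ a₂ a₃ u
          + (1 / 2) * ρ * (ρ + 1) * Real.log u ^ (-2 : ℝ) * a₁ u * u ^ (-2 : ℝ) * g u
          + g u * a₂ u * (∫ z in U, Kfun ρ u z ∂μ)
          + g u * a₃ u * (∫ z in Set.Ioi (0 : ℝ) \ U, Kfun ρ u z ∂ν) := by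
  intro u hu
  have hu0 : 0 < u := by linarith
  have hl : 0 < Real.log u := Real.log_pos (by linarith)
  have hge : g = fun x => Real.log x ^ (-ρ) := funext hg
  have hd1 : ∀ x, 1 < x → deriv g x = -ρ * Real.log x ^ (-ρ - 1) / x := by
    intro x hx
    rw [hge]; exact (aux_deriv ρ x hx).deriv
  have hd2 : deriv (deriv g) u =
      ρ * (ρ + 1) * Real.log u ^ (-ρ - 2) / u ^ 2 + ρ * Real.log u ^ (-ρ - 1) / u ^ 2 := by
    have : deriv g =ᶠ[nhds u] fun x => -ρ * Real.log x ^ (-ρ - 1) / x := by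
      filter_upwards [Ioi_mem_nhds (show 1 < u by linarith)] with x hx using hd1 x hx
    rw [this.deriv_eq]
    exact (aux_deriv2 ρ u (by linarith)).deriv
  have hV : MeasurableSet (Set.Ioi (0 : ℝ) \ U) := measurableSet_Ioi.diff hU
  have hKm : Measurable (fun z => Kfun ρ u z) := by
    unfold Kfun; fun_prop
  have hDm : Measurable (fun z => Real.log (u + z) - Real.log u) := by fun_prop
  -- integrability
  have iKμ : Integrable (fun z => Kfun ρ u z) (μ.restrict U) := by
    refine (hμ.const_mul (ρ + ρ ^ 2)).mono' hKm.aestronglyMeasurable ?_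
    filter_upwards [ae_restrict_mem hU] with z hz
    obtain ⟨h0, -, h2⟩ := aux_K ρ u z hρ hu (hUsub hz)
    rwa [Real.norm_of_nonneg h0]
  have iDμ : Integrable (fun z => z / u - (Real.log (u + z) - Real.log u)) (μ.restrict U) := by
    refine hμ.mono' (by fun_prop) ?_
    filter_upwards [ae_restrict_mem hU] with z hz
    obtain ⟨h0, h1, h2, h3, h4⟩ := aux_D u z hu (hUsub hz)
    rw [Real.norm_of_nonneg (by linarith)]
    exact le_min (by linarith) h3
  have iKν : Integrable (fun z => Kfun ρ u z) (ν.restrict (Set.Ioi 0 \ U)) := by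
    refine (hν.const_mul ρ).mono' hKm.aestronglyMeasurable ?_
    filter_upwards [ae_restrict_mem hV] with z hz
    obtain ⟨h0, h1, -⟩ := aux_K ρ u z hρ hu hz.1
    rw [Real.norm_of_nonneg h0]
    exact h1.trans (mul_le_mul_of_nonneg_left (le_max_right _ _) hρ.le)
  have iDν : Integrable (fun z => Real.log (u + z) - Real.log u)
      (ν.restrict (Set.Ioi 0 \ U)) := by
    refine hν.mono' hDm.aestronglyMeasurable ?_
    filter_upwards [ae_restrict_mem hV] with z hz
    obtain ⟨h0, h1, h2, h3, h4⟩ := aux_D u z hu hz.1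
    rw [Real.norm_of_nonneg h0]
    exact h2.trans (le_max_right _ _)
  have hp1 : Real.log u ^ (-ρ - 1) = g u / Real.log u := by
    rw [hg, Real.rpow_sub_one hl.ne']
  have hp2 : Real.log u ^ (-ρ - 2) = g u / Real.log u ^ 2 := by
    rw [hg, Real.rpow_sub hl, Real.rpow_two]
  have hgK : ∀ z, 0 < z → g u * Kfun ρ u z =
      g (u + z) - g u + ρ * Real.log u ^ (-ρ - 1) * (Real.log (u + z) - Real.log u) := by
    intro z hz
    have hlz : 0 < Real.log (u + z) := Real.log_pos (by linarith)
    have : g u * (Real.log (u + z) / Real.log u) ^ (-ρ) = g (u + z) := by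
      have : g u ≠ 0 := by rw [hg]; positivity
      rw [Real.div_rpow hlz.le hl.le, ← hg, ← hg]
      field_simp
    unfold Kfun
    rw [hp1, mul_sub, mul_add, this]
    field_simp
    ring
  have E1 : (∫ z in U, (g (u + z) - g u - z * deriv g u) ∂μ) =
      g u * (∫ z in U, Kfun ρ u z ∂μ) + ρ * Real.log u ^ (-ρ - 1) *
      (∫ z in U, z ^ 2 * (∫ v in (0 : ℝ)..1, (u + v * z) ^ (-2 : ℝ) * (1 - v)) ∂μ) := by
    rw [setIntegral_congr_fun hU (g := fun z => z / u - (Real.log (u + z) - Real.log u))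
      (fun z hz => aux_int2 u z hu (hUsub hz))]
    rw [← integral_const_mul, ← integral_const_mul,
      ← integral_add (iKμ.const_mul _) (iDμ.const_mul _)]
    refine setIntegral_congr_fun hU (fun z hz => ?_)
    rw [hgK z (hUsub hz), hd1 u (by linarith)]
    ring
  have E2 : (∫ z in Set.Ioi (0 : ℝ) \ U, (g (u + z) - g u) ∂ν) =
      g u * (∫ z in Set.Ioi (0 : ℝ) \ U, Kfun ρ u z ∂ν) - ρ * Real.log u ^ (-ρ - 1) *
      (∫ z in Set.Ioi (0 : ℝ) \ U, z * (∫ v in (0 : ℝ)..1, (u + v * z) ^ (-1 : ℝ)) ∂ν) := by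
    rw [setIntegral_congr_fun hV (g := fun z => Real.log (u + z) - Real.log u)
      (fun z hz => aux_int1 u z hu hz.1)]
    rw [← integral_const_mul, ← integral_const_mul,
      ← integral_sub (iKν.const_mul _) (iDν.const_mul _)]
    refine setIntegral_congr_fun hV (fun z hz => ?_)
    rw [hgK z hz.1]
    ring
  have hm2 : ∀ x : ℝ, 0 < x → x ^ (-2 : ℝ) = (x ^ 2)⁻¹ := by
    intro x hx
    rw [Real.rpow_neg hx.le, Real.rpow_two]
  unfold Lop phiFun
  rw [E1, E2, hd2, hd1 u (by linarith), hm2 u hu0, hm2 _ hl, Real.rpow_neg_one, hp2]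
  ring
end

section
/- Let ρ > 0, let u > 3, and let ν be a σ-finite Borel measure on (0,∞) with ∫_0^∞ max(1, ln(1+z)) ν(dz) < ∞. Then the function z ↦ K_ρ(u,z) is ν-integrable on (0,∞), i.e. ∫_0^∞ K_ρ(u,z) ν(dz) < ∞. -/
open MeasureTheory

theorem stmt_18 (ρ u : ℝ) (hρ : 0 < ρ) (hu : 3 < u) (ν : Measure ℝ) [SigmaFinite ν]
    (hν : Integrable (fun z => max 1 (Real.log (1 + z))) (ν.restrict (Set.Ioi 0))) :
    Integrable (fun z => Kfun ρ u z) (ν.restrict (Set.Ioi 0)) := by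
  have hlu : 0 < Real.log u := Real.log_pos (by linarith)
  refine Integrable.mono' (hν.const_mul (2 + ρ + ρ * (1 + 1 / Real.log u))) ?_ ?_
  · apply Measurable.aestronglyMeasurable
    unfold Kfun
    fun_prop
  · filter_upwards [ae_restrict_mem measurableSet_Ioi] with z hz
    have hz : 0 < z := hz
    have hM1 : 1 ≤ max 1 (Real.log (1 + z)) := le_max_left _ _
    have hM2 : Real.log (1 + z) ≤ max 1 (Real.log (1 + z)) := le_max_right _ _
    generalize max 1 (Real.log (1 + z)) = M at *
    have h1 : 1 ≤ Real.log (u + z) / Real.log u := by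
      rw [one_le_div hlu]
      exact Real.log_le_log (by linarith) (by linarith)
    have h2 : Real.log (u + z) ≤ Real.log u + Real.log (1 + z) := by
      rw [← Real.log_mul (by linarith) (by linarith)]
      exact Real.log_le_log (by linarith) (by nlinarith)
    have h3 : Real.log (u + z) / Real.log u ≤ (1 + 1 / Real.log u) * M := by
      rw [div_le_iff₀ hlu]
      have : (1 + 1 / Real.log u) * M * Real.log u = M * Real.log u + M := by
        field_simp
      rw [this]
      nlinarith
    unfold Kfun
    generalize Real.log (u + z) / Real.log u = r at *
    have h4 : r ^ (-ρ) ≤ 1 := Real.rpow_le_one_of_one_le_of_nonpos h1 (by linarith)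
    have h5 : 0 ≤ r ^ (-ρ) := Real.rpow_nonneg (by linarith) _
    have h6 := mul_le_mul_of_nonneg_left h3 hρ.le
    have h7 : 0 ≤ ρ * r := by nlinarith
    have h8 : ρ ≤ ρ * M := by nlinarith
    rw [Real.norm_eq_abs, abs_le]
    constructor <;> nlinarith
end

section
/- Let ρ > 0, let u > 3, and let μ be a σ-finite Borel measure on (0,∞) with ∫_0^∞ min(z, z^2) μ(dz) < ∞. Then the function z ↦ K_ρ(u,z) is μ-integrable on (0,∞), i.e. ∫_0^∞ K_ρ(u,z) μ(dz) < ∞. -/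
open MeasureTheory

theorem Kfun_bound (ρ u z : ℝ) (hρ : 0 < ρ) (hu : 3 < u) (hz : 0 < z) :
    |Kfun ρ u z| ≤ (ρ + ρ ^ 2) * min z (z ^ 2) := by
  have hlu : 1 < Real.log u := by
    rw [Real.lt_log_iff_exp_lt (by linarith)]
    linarith [Real.exp_one_lt_d9]
  obtain ⟨t, ht⟩ : ∃ t, t = Real.log (u + z) / Real.log u - 1 := ⟨_, rfl⟩
  have hw : Real.log (u + z) / Real.log u = 1 + t := by linarith
  have hdiff : Real.log (u + z) - Real.log u = Real.log ((u + z) / u) := by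
    rw [Real.log_div (by linarith) (by linarith)]
  have ht2 : t = (Real.log (u + z) - Real.log u) / Real.log u := by
    rw [ht]; field_simp
  have hmono : Real.log u ≤ Real.log (u + z) := Real.log_le_log (by linarith) (by linarith)
  have ht0 : 0 ≤ t := by
    rw [ht2]; exact div_nonneg (by linarith) (by linarith)
  have htz : t ≤ z := by
    rw [ht2, div_le_iff₀ (by linarith)]
    have h1 : Real.log ((u + z) / u) ≤ (u + z) / u - 1 :=
      Real.log_le_sub_one_of_pos (div_pos (by linarith) (by linarith))
    have h2 : (u + z) / u - 1 ≤ z := by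
      have : (u + z) / u - 1 = z / u := by field_simp; ring
      rw [this]; exact div_le_self hz.le (by linarith)
    nlinarith
  have hl1 : Real.log (1 + t) ≤ t := by
    have := Real.log_le_sub_one_of_pos (show 0 < 1 + t by linarith)
    linarith
  have hl0 : 0 ≤ Real.log (1 + t) := Real.log_nonneg (by linarith)
  have hl2 : t - t ^ 2 ≤ Real.log (1 + t) := by
    have h1 := Real.one_sub_inv_le_log_of_pos (show 0 < 1 + t by linarith)
    have h2 : t - t ^ 2 ≤ 1 - (1 + t)⁻¹ := by
      have : 1 - (1 + t)⁻¹ - (t - t ^ 2) = t ^ 3 / (1 + t) := by field_simp; ring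
      have : 0 ≤ t ^ 3 / (1 + t) := by positivity
      linarith
    linarith
  have hK : Kfun ρ u z = Real.exp (-(ρ * Real.log (1 + t))) - 1 + ρ * t := by
    unfold Kfun
    rw [hw, Real.rpow_def_of_pos (by linarith)]
    rw [show Real.log (1 + t) * -ρ = -(ρ * Real.log (1 + t)) by ring]; ring
  generalize Real.log (1 + t) = l at *
  have hx : 0 ≤ ρ * l := by positivity
  have he1 := Real.add_one_le_exp (-(ρ * l))
  have he2 : Real.exp (-(ρ * l)) ≤ 1 := Real.exp_le_one_iff.2 (by linarith)
  have he3 : Real.exp (-(ρ * l)) ≤ 1 - ρ * l + (ρ * l) ^ 2 := by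
    rw [Real.exp_neg]
    have h1 : (Real.exp (ρ * l))⁻¹ ≤ (1 + ρ * l)⁻¹ :=
      inv_anti₀ (by linarith) (by linarith [Real.add_one_le_exp (ρ * l)])
    have h2 : 1 - ρ * l + (ρ * l) ^ 2 - (1 + ρ * l)⁻¹ = (ρ * l) ^ 3 / (1 + ρ * l) := by
      field_simp; ring
    have : 0 ≤ (ρ * l) ^ 3 / (1 + ρ * l) := by positivity
    linarith
  have hρl : ρ * l ≤ ρ * t := by gcongr
  rw [hK, abs_of_nonneg (by linarith), mul_min_of_nonneg _ _ (by positivity)]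
  apply le_min
  · have : ρ * t ≤ ρ * z := by gcongr
    have : 0 ≤ ρ ^ 2 * z := by positivity
    linarith
  · have h1 : ρ * (t - t ^ 2) ≤ ρ * l := by gcongr
    have h2 : (ρ * l) ^ 2 ≤ (ρ * t) ^ 2 := by gcongr
    have h3 : (ρ + ρ ^ 2) * t ^ 2 ≤ (ρ + ρ ^ 2) * z ^ 2 := by gcongr
    nlinarith

theorem stmt_19 (ρ u : ℝ) (hρ : 0 < ρ) (hu : 3 < u) (μ : Measure ℝ) [SigmaFinite μ]
    (hμ : Integrable (fun z => min z (z ^ 2)) (μ.restrict (Set.Ioi 0))) :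
    Integrable (fun z => Kfun ρ u z) (μ.restrict (Set.Ioi 0)) := by
  refine (hμ.const_mul (ρ + ρ ^ 2)).mono' ?_ ?_
  · apply Measurable.aestronglyMeasurable
    unfold Kfun
    fun_prop
  · filter_upwards [ae_restrict_mem measurableSet_Ioi] with z hz
    exact Kfun_bound ρ u z hρ hu hz
end
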